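/- arXiv:2302.01772 — 12 statements merged into one kernel-verified Lean document; each statement's English description precedes it below -/
import Mathlib

section
/- Let n be a positive integer, f < n/2, and κ ≥ 0. Suppose F : (ℝ^d)^n → ℝ^d is a coordinate-wise aggregation function, i.e., there exist functions F_1, …, F_d : ℝ^n → ℝ such that for all x_1, …, x_n ∈ ℝ^d and every coordinate k ∈ {1,…,d}, the k-th coordinate of F(x_1,…,x_n) equals F_k([x_1]_k, …, [x_n]_k), where [x]_k denotes the k-th coordinate of x. If each F_k is (f,κ)-robust (as a function ℝ^n → ℝ, with d = 1), then F is (f,κ)-robust. -/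
/-- If `F` is a coordinate-wise aggregation function whose coordinate functions `Fk k`
are each `(f,κ)`-robust (as scalar aggregation rules), then `F` is `(f,κ)`-robust. -/
theorem cw_robust (n d f : ℕ) (hn : 0 < n) (hf : 2 * f < n) (κ : ℝ) (hκ : 0 ≤ κ)
    (F : (Fin n → EuclideanSpace ℝ (Fin d)) → EuclideanSpace ℝ (Fin d))
    (Fk : Fin d → (Fin n → ℝ) → ℝ)
    (hcw : ∀ (x : Fin n → EuclideanSpace ℝ (Fin d)) (k : Fin d),
      F x k = Fk k (fun i => x i k))
    (hrobust : ∀ (k : Fin d) (y : Fin n → ℝ) (S : Finset (Fin n)), S.card = n - f →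
      |Fk k y - (S.card : ℝ)⁻¹ * ∑ i ∈ S, y i| ^ 2 ≤
        (κ / (S.card : ℝ)) * ∑ i ∈ S, |y i - (S.card : ℝ)⁻¹ * ∑ j ∈ S, y j| ^ 2) :
    ∀ (x : Fin n → EuclideanSpace ℝ (Fin d)) (S : Finset (Fin n)), S.card = n - f →
      ‖F x - (S.card : ℝ)⁻¹ • ∑ i ∈ S, x i‖ ^ 2 ≤
        (κ / (S.card : ℝ)) * ∑ i ∈ S, ‖x i - (S.card : ℝ)⁻¹ • ∑ j ∈ S, x j‖ ^ 2 := by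
  intro x S hS
  simp only [EuclideanSpace.norm_sq_eq, Real.norm_eq_abs]
  rw [Finset.sum_comm, Finset.mul_sum]
  refine Finset.sum_le_sum fun k _ => ?_
  simpa [hcw] using hrobust k (fun i => x i k) S hS
end

section
/- Let n be a positive integer, f an integer with 0 ≤ f < n/2, and x_1, …, x_n real numbers with x_1 ≤ x_2 ≤ … ≤ x_n. Let S ⊆ {1,…,n} with |S| = n − f, let I = {f+1, …, n−f}, and let x̄_S = (1/|S|) Σ_{i∈S} x_i. Then Σ_{i ∈ I\S} |x_i − x̄_S|² ≤ Σ_{i ∈ S\I} |x_i − x̄_S|². -/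
theorem Finset.sum_le_sum_of_card_le_of_forall_le {ι : Type*} {A B : Finset ι} {g : ι → ℝ}
    (hcard : A.card ≤ B.card) (hle : ∀ a ∈ A, ∀ b ∈ B, g a ≤ g b) (hg : ∀ i, 0 ≤ g i) :
    ∑ i ∈ A, g i ≤ ∑ i ∈ B, g i := by
  rcases A.eq_empty_or_nonempty with rfl | hA
  · simpa using Finset.sum_nonneg fun i _ => hg i
  obtain ⟨m, hm, hmax⟩ := A.exists_max_image g hA
  calc ∑ i ∈ A, g i ≤ A.card • g m := Finset.sum_le_card_nsmul _ _ _ hmax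
    _ ≤ B.card • g m := nsmul_le_nsmul_left (hg m) hcard
    _ ≤ ∑ i ∈ B, g i := Finset.card_nsmul_le_sum _ _ _ (hle m hm)

theorem Finset.card_sdiff_le_card_inter {ι : Type*} [Fintype ι] [DecidableEq ι]
    {S I T : Finset ι} (hdisj : Disjoint I T) (hcard : Sᶜ.card ≤ T.card) :
    (I \ S).card ≤ (S ∩ T).card := by
  have hsub : (I \ S) ∪ (T \ S) ⊆ Sᶜ := by
    intro i hi
    simp only [Finset.mem_union, Finset.mem_sdiff, Finset.mem_compl] at hi ⊢
    tauto
  have hunion := Finset.card_le_card hsub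
  rw [Finset.card_union_of_disjoint
    (hdisj.mono Finset.sdiff_subset Finset.sdiff_subset)] at hunion
  have hT := Finset.card_inter_add_card_sdiff T S
  rw [Finset.inter_comm] at hT
  omega

/-- The domination of squared deviations holds about every centre `c`, not only about the mean. -/
theorem sum_sq_dev_trimmed_sdiff_le {n f : ℕ} (hf : 2 * f < n) {x : Fin n → ℝ}
    (hx : Monotone x) {S : Finset (Fin n)} (hS : S.card = n - f) (c : ℝ) :
    let I : Finset (Fin n) := Finset.univ.filter (fun i => f ≤ (i : ℕ) ∧ (i : ℕ) < n - f)
    ∑ i ∈ I \ S, |x i - c| ^ 2 ≤ ∑ i ∈ S \ I, |x i - c| ^ 2 := by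
  intro I
  set L : Finset (Fin n) := Finset.univ.filter (fun i => (i : ℕ) < f) with hL
  set U : Finset (Fin n) := Finset.univ.filter (fun i => ¬ (i : ℕ) < n - f) with hU
  have hScompl : Sᶜ.card = f := by
    rw [Finset.card_compl, Fintype.card_fin, hS]
    omega
  have hLcard : L.card = f := by
    rw [hL, Fin.card_filter_val_lt]
    omega
  have hUcard : U.card = f := by
    rw [hU, Finset.filter_not, ← Finset.compl_eq_univ_sdiff, Finset.card_compl,
      Fin.card_filter_val_lt, Fintype.card_fin]
    omega
  have hIL : Disjoint I L := by
    rw [Finset.disjoint_left]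
    simp only [I, L, Finset.mem_filter, Finset.mem_univ, true_and]
    omega
  have hIU : Disjoint I U := by
    rw [Finset.disjoint_left]
    simp only [I, U, Finset.mem_filter, Finset.mem_univ, true_and]
    omega
  have hLU : Disjoint (S ∩ U) (S ∩ L) := by
    rw [Finset.disjoint_left]
    simp only [L, U, Finset.mem_inter, Finset.mem_filter, Finset.mem_univ, true_and]
    omega
  have hsplit : S \ I = (S ∩ U) ∪ (S ∩ L) := by
    ext i
    simp only [I, L, U, Finset.mem_union, Finset.mem_sdiff, Finset.mem_inter,
      Finset.mem_filter, Finset.mem_univ, true_and, ← and_or_left]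
    refine and_congr_right fun _ => ?_
    omega
  rw [hsplit, Finset.sum_union hLU, ← Finset.sum_filter_add_sum_filter_not (I \ S) (c ≤ x ·)]
  refine add_le_add
    (Finset.sum_le_sum_of_card_le_of_forall_le ?_ ?_ fun i => by positivity)
    (Finset.sum_le_sum_of_card_le_of_forall_le ?_ ?_ fun i => by positivity)
  · exact (Finset.card_filter_le _ _).trans
      (Finset.card_sdiff_le_card_inter hIU (hScompl.trans hUcard.symm).le)
  · intro a ha b hb
    simp only [I, U, Finset.mem_sdiff, Finset.mem_inter, Finset.mem_filter, Finset.mem_univ,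
      true_and] at ha hb
    have hab : x a ≤ x b := hx (Fin.le_def.2 (by omega))
    rw [sq_abs, sq_abs]
    nlinarith [ha.2]
  · exact (Finset.card_filter_le _ _).trans
      (Finset.card_sdiff_le_card_inter hIL (hScompl.trans hLcard.symm).le)
  · intro a ha b hb
    simp only [I, L, Finset.mem_sdiff, Finset.mem_inter, Finset.mem_filter, Finset.mem_univ,
      true_and, not_le] at ha hb
    have hab : x b ≤ x a := hx (Fin.le_def.2 (by omega))
    rw [sq_abs, sq_abs]
    nlinarith [ha.2]

/-- Key sorting lemma for the trimmed mean: for sorted reals `x₁ ≤ … ≤ xₙ`,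
with `I = {f+1, …, n-f}` (here zero-indexed as `{i : f ≤ i < n - f}`) and any
`S ⊆ [n]` of size `n - f`, the squared deviations (from the mean over `S`) of
values in `I \ S` are dominated by those of values in `S \ I`. -/
theorem tmean_main (n f : ℕ) (hn : 0 < n) (hf : 2 * f < n) (x : Fin n → ℝ)
    (hsorted : Monotone x) (S : Finset (Fin n)) (hS : S.card = n - f) :
    let I : Finset (Fin n) := Finset.univ.filter (fun i => f ≤ (i : ℕ) ∧ (i : ℕ) < n - f)
    let xbar : ℝ := (S.card : ℝ)⁻¹ * ∑ i ∈ S, x i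
    ∑ i ∈ I \ S, |x i - xbar| ^ 2 ≤ ∑ i ∈ S \ I, |x i - xbar| ^ 2 := by
  exact sum_sq_dev_trimmed_sdiff_le hf hsorted hS _
end

section
/- Let n be a positive integer and f an integer with 0 ≤ f < n/2. Let x_1 ≤ x_2 ≤ … ≤ x_n be real numbers, let TM(x_1,…,x_n) = (1/(n−2f)) Σ_{i=f+1}^{n−f} x_i, and let S ⊆ {1,…,n} with |S| = n − f and x̄_S = (1/|S|) Σ_{i∈S} x_i. Then |TM(x_1,…,x_n) − x̄_S|² ≤ (6f/(n−2f)²) · Σ_{i∈S} |x_i − x̄_S|². -/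
theorem StrictMono.fin_val_add_le {m n : ℕ} {e : Fin m → Fin n} (he : StrictMono e) (i d : ℕ)
    (h : i + d < m) : (e ⟨i, by omega⟩ : ℕ) + d ≤ e ⟨i + d, h⟩ := by
  induction d with
  | zero => simp
  | succ d ih =>
    have h₁ := ih (by omega)
    have h₂ : e ⟨i + d, by omega⟩ < e ⟨i + (d + 1), h⟩ := he (by simp [Fin.lt_def])
    rw [Fin.lt_def] at h₂
    omega

/-- Interlacing: if `∑ z (e k) = 0` for `n - f` entries of a sorted sequence, picked by a strictly
increasing `e`, then the sum of the middle `n - 2f` entries is controlled by the sum of squares. -/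
theorem sq_sum_middle_le {n f : ℕ} (hf : 2 * f < n) {z : Fin n → ℝ} (hz : Monotone z)
    {e : Fin (n - f) → Fin n} (he : StrictMono e) (h0 : ∑ k, z (e k) = 0) :
    (∑ i ∈ Finset.univ.filter (fun i : Fin n => f ≤ (i : ℕ) ∧ (i : ℕ) < n - f), z i) ^ 2 ≤
      f * ∑ k, z (e k) ^ 2 := by
  have tail (p : Fin (n - f) → Prop) [DecidablePred p]
      (hp : (Finset.univ.filter fun k => ¬ p k).card ≤ f) :
      (∑ k with p k, z (e k)) ^ 2 ≤ f * ∑ k, z (e k) ^ 2 := by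
    have hs := Finset.sum_filter_add_sum_filter_not Finset.univ p fun k => z (e k)
    rw [h0] at hs
    rw [eq_neg_of_add_eq_zero_left hs, neg_sq]
    refine sq_sum_le_card_mul_sum_sq.trans ?_
    gcongr
    exact Finset.filter_subset _ _
  have upper : ∑ i ∈ Finset.univ.filter (fun i : Fin n => f ≤ (i : ℕ) ∧ (i : ℕ) < n - f), z i ≤
      ∑ k ∈ Finset.univ.filter (fun k : Fin (n - f) => f ≤ (k : ℕ)), z (e k) := by
    calc _ = ∑ k ∈ Finset.univ.filter (fun k : Fin (n - f) => f ≤ (k : ℕ)),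
          z (k.castLE (Nat.sub_le n f)) := by
          symm
          refine Finset.sum_bij (fun k _ => k.castLE (Nat.sub_le n f)) ?_ ?_ ?_ ?_
          · intro k hk
            have := k.2
            simp_all
          · intro a _ b _ hab
            simpa [Fin.ext_iff] using hab
          · intro b hb
            simp only [Finset.mem_filter, Finset.mem_univ, true_and] at hb
            exact ⟨⟨b, hb.2⟩, by simpa using hb.1, rfl⟩
          · intros
            rfl
      _ ≤ _ := by
          refine Finset.sum_le_sum fun k _ => hz ?_
          have h := he.fin_val_add_le 0 k (by omega)
          simp only [zero_add, Fin.eta] at h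
          rw [Fin.le_def, Fin.val_castLE]
          omega
  have lower : ∑ k ∈ Finset.univ.filter (fun k : Fin (n - f) => (k : ℕ) < n - 2 * f), z (e k) ≤
      ∑ i ∈ Finset.univ.filter (fun i : Fin n => f ≤ (i : ℕ) ∧ (i : ℕ) < n - f), z i := by
    calc _ ≤ ∑ k ∈ Finset.univ.filter (fun k : Fin (n - f) => (k : ℕ) < n - 2 * f),
          z ⟨k + f, by omega⟩ := by
          refine Finset.sum_le_sum fun k _ => hz ?_
          have h := he.fin_val_add_le k (n - f - 1 - k) (by omega)
          have h' := (e ⟨k + (n - f - 1 - k), by omega⟩).2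
          simp only [Fin.eta] at h
          rw [Fin.le_def]
          simp only
          omega
      _ = _ := by
          refine Finset.sum_bij (fun k _ => ⟨k + f, by omega⟩) ?_ ?_ ?_ ?_
          · intro k hk
            simp only [Finset.mem_filter, Finset.mem_univ, true_and] at hk ⊢
            omega
          · intro a _ b _ hab
            simpa [Fin.ext_iff] using hab
          · intro b hb
            simp only [Finset.mem_filter, Finset.mem_univ, true_and] at hb
            refine ⟨⟨b - f, by omega⟩, ?_, ?_⟩
            · simp only [Finset.mem_filter, Finset.mem_univ, true_and]
              omega
            · simp only [Fin.ext_iff]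
              omega
          · intros
            rfl
  have hU := tail (fun k => f ≤ (k : ℕ)) <| by
    refine (Finset.card_le_card_of_injOn (t := Finset.range f) Fin.val ?_
      Fin.val_injective.injOn).trans (Finset.card_range f).le
    intro k hk
    simpa using hk
  have hL := tail (fun k => (k : ℕ) < n - 2 * f) <| by
    refine (Finset.card_le_card_of_injOn (t := Finset.Ico (n - 2 * f) (n - f)) Fin.val ?_
      Fin.val_injective.injOn).trans ?_
    · intro k hk
      have := k.2
      simp_all
    · rw [Nat.card_Ico]
      omega
  rcases le_total 0
    (∑ i ∈ Finset.univ.filter (fun i : Fin n => f ≤ (i : ℕ) ∧ (i : ℕ) < n - f), z i) with h | h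
  · exact (pow_le_pow_left₀ h upper 2).trans hU
  · refine le_trans ?_ hL
    nlinarith


/-- Scalar trimmed-mean bound: for sorted reals `x₁ ≤ … ≤ xₙ`, the trimmed mean
`TM = (1/(n-2f)) ∑_{i ∈ I} x i` (with `I` the zero-indexed set `{i : f ≤ i < n - f}`,
i.e. discarding the `f` smallest and `f` largest values) satisfies
`|TM - x̄_S|² ≤ (6f/(n-2f)²) ∑_{i ∈ S} |x i - x̄_S|²` for every `S` of size `n - f`. -/
theorem tmean_bound (n f : ℕ) (hn : 0 < n) (hf : 2 * f < n) (x : Fin n → ℝ)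
    (hsorted : Monotone x) (S : Finset (Fin n)) (hS : S.card = n - f) :
    let I : Finset (Fin n) := Finset.univ.filter (fun i => f ≤ (i : ℕ) ∧ (i : ℕ) < n - f)
    let TM : ℝ := ((n : ℝ) - 2 * f)⁻¹ * ∑ i ∈ I, x i
    let xbar : ℝ := (S.card : ℝ)⁻¹ * ∑ i ∈ S, x i
    |TM - xbar| ^ 2 ≤ (6 * f / ((n : ℝ) - 2 * f) ^ 2) * ∑ i ∈ S, |x i - xbar| ^ 2 := by
  intro I TM xbar
  have hfn : (2 * f : ℝ) < n := by exact_mod_cast hf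
  have hpos : (0 : ℝ) < n - 2 * f := by linarith
  have hSpos : (0 : ℝ) < S.card := by
    rw [hS]
    exact_mod_cast (by omega : 0 < n - f)
  have hIcard : (I.card : ℝ) = n - 2 * f := by
    have h : I.card = n - 2 * f := by
      have himage : I.map Fin.valEmbedding = Finset.Ico f (n - f) := by
        ext j
        simp only [I, Finset.mem_map, Finset.mem_filter, Finset.mem_univ, true_and,
          Fin.valEmbedding_apply, Finset.mem_Ico]
        constructor
        · rintro ⟨a, ha, rfl⟩
          exact ha
        · intro hj
          exact ⟨⟨j, by omega⟩, hj, rfl⟩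
      rw [← Finset.card_map Fin.valEmbedding, himage, Nat.card_Ico]
      omega
    rw [h, Nat.cast_sub hf.le]
    push_cast
    ring
  let e := S.orderEmbOfFin hS
  have hsum (g : Fin n → ℝ) : ∑ k, g (e k) = ∑ i ∈ S, g i := by
    conv_rhs => rw [← S.map_orderEmbOfFin_univ hS, Finset.sum_map]
    rfl
  have h0 : ∑ k, (x (e k) - xbar) = 0 := by
    rw [hsum fun i => x i - xbar, Finset.sum_sub_distrib, Finset.sum_const, nsmul_eq_mul]
    simp only [xbar]
    field_simp
    ring
  have key := sq_sum_middle_le hf (z := fun i => x i - xbar)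
    (fun a b hab => sub_le_sub_right (hsorted hab) _) e.strictMono h0
  rw [hsum fun i => (x i - xbar) ^ 2] at key
  have hTM : TM - xbar = (∑ i ∈ I, (x i - xbar)) / (n - 2 * f) := by
    rw [Finset.sum_sub_distrib, Finset.sum_const, nsmul_eq_mul, hIcard]
    simp only [TM]
    field_simp
  simp only [sq_abs]
  rw [hTM, div_pow, div_mul_eq_mul_div]
  gcongr
  refine key.trans ?_
  gcongr
  linarith [(Nat.cast_nonneg f : (0 : ℝ) ≤ f)]
end

section
/- Let n be a positive integer, f an integer with 0 ≤ f < n/2, and x_1, …, x_n ∈ ℝ^d. For each j ∈ {1,…,n}, let N_j ⊆ {1,…,n} with |N_j| = n − f be a set of indices of n − f nearest neighbors of x_j among x_1,…,x_n (i.e., for all i ∈ N_j and l ∉ N_j, ‖x_j − x_i‖ ≤ ‖x_j − x_l‖). Let k* ∈ argmin_{j ∈ {1,…,n}} Σ_{i ∈ N_j} ‖x_j − x_i‖². Then for every subset S ⊆ {1,…,n} with |S| = n − f, letting x̄_S = (1/|S|) Σ_{i∈S} x_i, it holds that Σ_{i ∈ N_{k*}} ‖x_{k*} − x_i‖² ≤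 2 Σ_{i ∈ S} ‖x_i − x̄_S‖². -/
/-- If every value of `a` on `N` is at most every value off `N`, then `N` minimizes the sum of `a`
among finsets of its cardinality. -/
theorem Finset.sum_le_sum_of_forall_mem_le_notMem {ι : Type*} [DecidableEq ι] {N S : Finset ι}
    (hcard : N.card = S.card) {a : ι → ℝ} (h : ∀ i ∈ N, ∀ l ∉ N, a i ≤ a l) :
    ∑ i ∈ N, a i ≤ ∑ i ∈ S, a i := by
  have hsdiff : (N \ S).card = (S \ N).card := Finset.card_sdiff_comm hcard
  have key : ∑ i ∈ N \ S, a i ≤ ∑ i ∈ S \ N, a i := by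
    rw [← Finset.sum_coe_sort (N \ S), ← Finset.sum_coe_sort (S \ N),
      ← Equiv.sum_comp (Finset.equivOfCardEq hsdiff)]
    refine Finset.sum_le_sum fun i _ => h _ (Finset.mem_sdiff.1 i.2).1 _ ?_
    exact (Finset.mem_sdiff.1 (Finset.equivOfCardEq hsdiff i).2).2
  rw [← Finset.sum_inter_add_sum_sdiff N S, ← Finset.sum_inter_add_sum_sdiff S N,
    Finset.inter_comm S N]
  gcongr

/-- The sum of all pairwise squared distances is `2 * S.card` times the sum of squared distances
to the mean. -/
theorem sum_sum_norm_sub_sq_eq {ι E : Type*} [NormedAddCommGroup E] [InnerProductSpace ℝ E]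
    (S : Finset ι) (x : ι → E) :
    ∑ j ∈ S, ∑ i ∈ S, ‖x j - x i‖ ^ 2 =
      S.card * (2 * ∑ i ∈ S, ‖x i - (S.card : ℝ)⁻¹ • ∑ j ∈ S, x j‖ ^ 2) := by
  rcases S.eq_empty_or_nonempty with rfl | hS
  · simp
  have hcard : (S.card : ℝ) ≠ 0 := by exact_mod_cast hS.card_ne_zero
  set m := (S.card : ℝ)⁻¹ • ∑ j ∈ S, x j with hm
  have hzero : ∑ i ∈ S, (x i - m) = 0 := by
    rw [Finset.sum_sub_distrib, Finset.sum_const, ← Nat.cast_smul_eq_nsmul ℝ, hm,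
      smul_inv_smul₀ hcard, sub_self]
  have hexpand (j i : ι) : ‖x j - x i‖ ^ 2 =
      ‖x j - m‖ ^ 2 - 2 * inner ℝ (x j - m) (x i - m) + ‖x i - m‖ ^ 2 := by
    rw [← norm_sub_sq_real, sub_sub_sub_cancel_right]
  simp only [hexpand, Finset.sum_add_distrib, Finset.sum_sub_distrib, ← Finset.mul_sum,
    ← inner_sum, hzero, inner_zero_right, Finset.sum_const, nsmul_eq_mul, mul_zero]
  ring

/-- Krum's key lemma: if `k` is the index selected by Krum (minimizing the sum of
squared distances to its `n - f` nearest neighbors `N j`), then for every `S` of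
size `n - f`, `∑_{i ∈ N k} ‖x k - x i‖² ≤ 2 ∑_{i ∈ S} ‖x i - x̄_S‖²`. -/
theorem krum_score_bound (n d f : ℕ) (hn : 0 < n) (hf : 2 * f < n)
    (x : Fin n → EuclideanSpace ℝ (Fin d))
    (N : Fin n → Finset (Fin n))
    (hNcard : ∀ j, (N j).card = n - f)
    (hNnear : ∀ j : Fin n, ∀ i ∈ N j, ∀ l ∉ N j, ‖x j - x i‖ ≤ ‖x j - x l‖)
    (k : Fin n)
    (hk : ∀ j : Fin n, ∑ i ∈ N k, ‖x k - x i‖ ^ 2 ≤ ∑ i ∈ N j, ‖x j - x i‖ ^ 2)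
    (S : Finset (Fin n)) (hS : S.card = n - f) :
    ∑ i ∈ N k, ‖x k - x i‖ ^ 2 ≤
      2 * ∑ i ∈ S, ‖x i - (S.card : ℝ)⁻¹ • ∑ j ∈ S, x j‖ ^ 2 := by
  have hpos : (0 : ℝ) < S.card := by
    rw [hS]
    exact_mod_cast (by omega : 0 < n - f)
  refine le_of_mul_le_mul_left ?_ hpos
  rw [← sum_sum_norm_sub_sq_eq, ← nsmul_eq_mul]
  refine Finset.card_nsmul_le_sum _ _ _ fun j _ => (hk j).trans ?_
  refine Finset.sum_le_sum_of_forall_mem_le_notMem ((hNcard j).trans hS.symm) fun i hi l hl => ?_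
  gcongr
  exact hNnear j i hi l hl
end

section
/- Let n be a positive integer, f an integer with 0 ≤ f < n/2, and x_1, …, x_n ∈ ℝ^d. Let x* ∈ ℝ^d be any minimizer over y ∈ ℝ^d of Σ_{i=1}^n ‖y − x_i‖. Then for every subset S ⊆ {1,…,n} with |S| = n − f, letting x̄_S = (1/|S|) Σ_{i∈S} x_i, it holds that ‖x* − x̄_S‖ ≤ (2/(n−2f)) · Σ_{i∈S} ‖x_i − x̄_S‖. -/
/-- If moving from `a` to `c` does not decrease the sum of distances to the points `x i`, then
the distance from `a` to `c` is controlled by the distances from `c` to the points indexed by `S`. -/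
theorem card_sub_card_compl_mul_norm_sub_le {ι E : Type*} [Fintype ι] [DecidableEq ι]
    [SeminormedAddCommGroup E] (x : ι → E) (a c : E)
    (h : ∑ i, ‖a - x i‖ ≤ ∑ i, ‖c - x i‖) (S : Finset ι) :
    ((S.card : ℝ) - (Sᶜ.card : ℝ)) * ‖a - c‖ ≤ 2 * ∑ i ∈ S, ‖x i - c‖ := by
  have h_in : ∑ i ∈ S, (‖a - c‖ - ‖x i - c‖) ≤ ∑ i ∈ S, ‖a - x i‖ :=
    Finset.sum_le_sum fun i _ ↦ by linarith [norm_sub_le_norm_sub_add_norm_sub a (x i) c]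
  have h_out : ∑ i ∈ Sᶜ, (‖c - x i‖ - ‖a - c‖) ≤ ∑ i ∈ Sᶜ, ‖a - x i‖ :=
    Finset.sum_le_sum fun i _ ↦ by
      linarith [norm_sub_le_norm_sub_add_norm_sub c a (x i), norm_sub_rev a c]
  rw [← Finset.sum_add_sum_compl S, ← Finset.sum_add_sum_compl S (fun i ↦ ‖c - x i‖)] at h
  have h_rev : ∑ i ∈ S, ‖c - x i‖ = ∑ i ∈ S, ‖x i - c‖ :=
    Finset.sum_congr rfl fun i _ ↦ norm_sub_rev _ _
  simp only [Finset.sum_sub_distrib, Finset.sum_const, nsmul_eq_mul] at h_in h_out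
  linarith


/-- Geometric median distance bound: if `xstar` minimizes `y ↦ ∑ᵢ ‖y - xᵢ‖`, then
for every `S` of size `n - f`, `‖xstar - x̄_S‖ ≤ (2/(n-2f)) ∑_{i ∈ S} ‖x i - x̄_S‖`. -/
theorem gm_dist_bound (n d f : ℕ) (hn : 0 < n) (hf : 2 * f < n)
    (x : Fin n → EuclideanSpace ℝ (Fin d))
    (xstar : EuclideanSpace ℝ (Fin d))
    (hmin : ∀ y : EuclideanSpace ℝ (Fin d),
      ∑ i, ‖xstar - x i‖ ≤ ∑ i, ‖y - x i‖)
    (S : Finset (Fin n)) (hS : S.card = n - f) :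
    ‖xstar - (S.card : ℝ)⁻¹ • ∑ i ∈ S, x i‖ ≤
      (2 / ((n : ℝ) - 2 * f)) * ∑ i ∈ S, ‖x i - (S.card : ℝ)⁻¹ • ∑ j ∈ S, x j‖ := by
  have hpos : (0 : ℝ) < (n : ℝ) - 2 * f := by
    rw [sub_pos]
    exact_mod_cast hf
  have hcompl : Sᶜ.card = f := by
    rw [Finset.card_compl, hS, Fintype.card_fin]
    omega
  have key := card_sub_card_compl_mul_norm_sub_le x xstar
    ((S.card : ℝ)⁻¹ • ∑ i ∈ S, x i) (hmin _) S
  have hcard : (S.card : ℝ) - (Sᶜ.card : ℝ) = (n : ℝ) - 2 * f := by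
    rw [hcompl, hS, Nat.cast_sub (by omega)]
    ring
  rw [hcard] at key
  rw [div_mul_eq_mul_div, le_div_iff₀ hpos, mul_comm]
  exact key
end

section
/- Let n be a positive integer and f an integer with 0 ≤ f < n/2. The coordinate-wise median CWMed is (f,κ)-robust with κ = 4·(1 + f/(n−2f))². Precisely: for all x_1, …, x_n ∈ ℝ^d, for any vector m ∈ ℝ^d such that for each coordinate k ∈ {1,…,d} the real number [m]_k minimizes y ↦ Σ_{i=1}^n |y − [x_i]_k| over ℝ, and for every S ⊆ {1,…,n} with |S| = n − f, it holds that ‖m − x̄_S‖² ≤ (4·(1 + f/(n−2f))² / |S|) · Σ_{i∈S} ‖x_i − x̄_S‖², where x̄_S = (1/|S|) Σ_{i∈S} x_i. -/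
/-- If the total distance from `m` to the points `y i` is at most that from `a`, then the distance
between `m` and `a` is controlled by the deviations from `a` on any subset `S`. -/
theorem card_sub_card_compl_mul_abs_sub_le {ι : Type*} [Fintype ι] [DecidableEq ι]
    (S : Finset ι) (y : ι → ℝ) {m a : ℝ} (h : ∑ i, |m - y i| ≤ ∑ i, |a - y i|) :
    ((S.card : ℝ) - (Sᶜ.card : ℝ)) * |m - a| ≤ 2 * ∑ i ∈ S, |y i - a| := by
  rw [← Finset.sum_add_sum_compl S, ← Finset.sum_add_sum_compl S] at h
  have hin : ∑ i ∈ S, (|m - a| - |y i - a|) ≤ ∑ i ∈ S, |m - y i| :=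
    Finset.sum_le_sum fun i _ ↦ by
      linarith [abs_sub_le m (y i) a]
  have hout : ∑ i ∈ Sᶜ, (|a - y i| - |m - a|) ≤ ∑ i ∈ Sᶜ, |m - y i| :=
    Finset.sum_le_sum fun i _ ↦ by
      linarith [abs_sub_le a m (y i), abs_sub_comm a m]
  have hcomm : ∑ i ∈ S, |a - y i| = ∑ i ∈ S, |y i - a| :=
    Finset.sum_congr rfl fun i _ ↦ abs_sub_comm _ _
  simp only [Finset.sum_sub_distrib, Finset.sum_const, nsmul_eq_mul] at hin hout
  linarith

/-- Quadratic form of `card_sub_card_compl_mul_abs_sub_le`, for a majority subset `S`. -/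
theorem sq_card_sub_card_compl_mul_sq_sub_le {ι : Type*} [Fintype ι] [DecidableEq ι]
    (S : Finset ι) (hS : Sᶜ.card ≤ S.card) (y : ι → ℝ) {m a : ℝ}
    (h : ∑ i, |m - y i| ≤ ∑ i, |a - y i|) :
    ((S.card : ℝ) - (Sᶜ.card : ℝ)) ^ 2 * (m - a) ^ 2 ≤
      4 * S.card * ∑ i ∈ S, (y i - a) ^ 2 := by
  have hS' : (0 : ℝ) ≤ (S.card : ℝ) - (Sᶜ.card : ℝ) := sub_nonneg.2 (by exact_mod_cast hS)
  have hsq := pow_le_pow_left₀ (by positivity) (card_sub_card_compl_mul_abs_sub_le S y h) 2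
  have hcs := sq_sum_le_card_mul_sum_sq (s := S) (f := fun i ↦ |y i - a|)
  simp only [mul_pow, sq_abs] at hsq hcs
  linarith

/-- The coordinate-wise median is `(f,κ)`-robust with `κ = 4 (1 + f/(n-2f))²`:
here `m` is any vector whose `k`-th coordinate minimizes `y ↦ ∑ᵢ |y - [xᵢ]ₖ|`. -/
theorem cwmed_robust (n d f : ℕ) (hn : 0 < n) (hf : 2 * f < n)
    (x : Fin n → EuclideanSpace ℝ (Fin d))
    (m : EuclideanSpace ℝ (Fin d))
    (hmed : ∀ k : Fin d, ∀ y : ℝ, ∑ i, |m k - x i k| ≤ ∑ i, |y - x i k|)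
    (S : Finset (Fin n)) (hS : S.card = n - f) :
    ‖m - (S.card : ℝ)⁻¹ • ∑ i ∈ S, x i‖ ^ 2 ≤
      (4 * (1 + (f : ℝ) / ((n : ℝ) - 2 * f)) ^ 2 / (S.card : ℝ)) *
        ∑ i ∈ S, ‖x i - (S.card : ℝ)⁻¹ • ∑ j ∈ S, x j‖ ^ 2 := by
  generalize (S.card : ℝ)⁻¹ • ∑ i ∈ S, x i = a
  have hSc : Sᶜ.card = f := by
    rw [Finset.card_compl, Fintype.card_fin]
    omega
  have hle : Sᶜ.card ≤ S.card := by omega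
  have hcard : (S.card : ℝ) = n - f := by
    rw [hS, Nat.cast_sub (by omega)]
  have hgap : (0 : ℝ) < n - 2 * f := sub_pos.2 (by exact_mod_cast hf)
  have hpos : (0 : ℝ) < n - f := by linarith [(Nat.cast_nonneg f : (0 : ℝ) ≤ f)]
  have hκ : 4 * (1 + (f : ℝ) / ((n : ℝ) - 2 * f)) ^ 2 / (S.card : ℝ) =
      4 * S.card / ((n : ℝ) - 2 * f) ^ 2 := by
    rw [hcard, one_add_div hgap.ne']
    field_simp
    ring
  rw [hκ, div_mul_eq_mul_div, le_div_iff₀ (by positivity)]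
  simp only [EuclideanSpace.real_norm_sq_eq, PiLp.sub_apply]
  rw [Finset.sum_comm, Finset.sum_mul, Finset.mul_sum]
  refine Finset.sum_le_sum fun k _ ↦ ?_
  have key := sq_card_sub_card_compl_mul_sq_sub_le S hle (fun i ↦ x i k) (hmed k (a k))
  rw [hSc, show (S.card : ℝ) - f = n - 2 * f by rw [hcard]; ring] at key
  linarith
end

section
/- Let n be a positive integer, f an integer with 0 ≤ f < n, and κ > 0. If there exists an aggregation rule F : ℝ^n → ℝ that is (f,κ)-robust (i.e., for all x_1,…,x_n ∈ ℝ and all S ⊆ {1,…,n} with |S| = n − f, |F(x_1,…,x_n) − x̄_S|² ≤ (κ/|S|) Σ_{i∈S} |x_i − x̄_S|²), then n > 2f. -/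
/-- A robust aggregation rule returns the common value of any input that is constant on an
admissible set of indices. -/
theorem robust_eq_of_const_on {ι : Type*} {a κ c : ℝ} {x : ι → ℝ} {S : Finset ι}
    (hS : S.Nonempty) (hx : ∀ i ∈ S, x i = c)
    (h : |a - (S.card : ℝ)⁻¹ * ∑ i ∈ S, x i| ^ 2 ≤
      (κ / (S.card : ℝ)) * ∑ i ∈ S, |x i - (S.card : ℝ)⁻¹ * ∑ j ∈ S, x j| ^ 2) :
    a = c := by
  have hcard : (S.card : ℝ) ≠ 0 := by exact_mod_cast hS.card_ne_zero
  have hmean : (S.card : ℝ)⁻¹ * ∑ i ∈ S, x i = c := by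
    rw [Finset.sum_congr rfl hx, Finset.sum_const, nsmul_eq_mul, inv_mul_cancel_left₀ hcard]
  have hdev : ∑ i ∈ S, |x i - c| ^ 2 = 0 :=
    Finset.sum_eq_zero fun i hi => by simp [hx i hi]
  rw [hmean, hdev, mul_zero, sq_abs] at h
  exact sub_eq_zero.mp (pow_eq_zero_iff two_ne_zero |>.mp (le_antisymm h (sq_nonneg _)))

/-- If there exists an `(f,κ)`-robust aggregation rule `F : ℝⁿ → ℝ` with `κ > 0`
and `f < n`, then necessarily `n > 2f`. -/
theorem robust_implies_n_gt_2f (n f : ℕ) (hn : 0 < n) (hf : f < n) (κ : ℝ) (hκ : 0 < κ)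
    (F : (Fin n → ℝ) → ℝ)
    (hrobust : ∀ (x : Fin n → ℝ) (S : Finset (Fin n)), S.card = n - f →
      |F x - (S.card : ℝ)⁻¹ * ∑ i ∈ S, x i| ^ 2 ≤
        (κ / (S.card : ℝ)) * ∑ i ∈ S, |x i - (S.card : ℝ)⁻¹ * ∑ j ∈ S, x j| ^ 2) :
    n > 2 * f := by
  by_contra! hle
  obtain ⟨S, -, hS⟩ := Finset.exists_subset_card_eq
    (show n - f ≤ (Finset.univ : Finset (Fin n)).card by simp)
  obtain ⟨T, hTS, hT⟩ := Finset.exists_subset_card_eq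
    (show n - f ≤ Sᶜ.card by rw [Finset.card_compl, Fintype.card_fin]; omega)
  let x : Fin n → ℝ := fun i => if i ∈ S then 1 else 0
  have hone : F x = 1 :=
    robust_eq_of_const_on (x := x) (Finset.card_pos.mp (by omega)) (fun i hi => if_pos hi)
      (hrobust x S hS)
  have hzero : F x = 0 :=
    robust_eq_of_const_on (x := x) (Finset.card_pos.mp (by omega))
      (fun i hi => if_neg (Finset.mem_compl.mp (hTS hi))) (hrobust x T hT)
  exact one_ne_zero (hone.symm.trans hzero)
end

section
/- Let n be a positive integer, f an integer with 1 ≤ f and n > 2f, and κ > 0. If an aggregation rule F : ℝ^n → ℝ is (f,κ)-robust, then κ ≥ f/(n−2f). -/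
/-- Universal lower bound: any `(f,κ)`-robust aggregation rule `F : ℝⁿ → ℝ` with
`f ≥ 1` and `n > 2f` must have `κ ≥ f/(n-2f)`. -/
theorem robust_kappa_lower_bound (n f : ℕ) (hn : 0 < n) (hf1 : 1 ≤ f) (hf : 2 * f < n)
    (κ : ℝ) (hκ : 0 < κ)
    (F : (Fin n → ℝ) → ℝ)
    (hrobust : ∀ (x : Fin n → ℝ) (S : Finset (Fin n)), S.card = n - f →
      |F x - (S.card : ℝ)⁻¹ * ∑ i ∈ S, x i| ^ 2 ≤
        (κ / (S.card : ℝ)) * ∑ i ∈ S, |x i - (S.card : ℝ)⁻¹ * ∑ j ∈ S, x j| ^ 2) :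
    κ ≥ (f : ℝ) / ((n : ℝ) - 2 * f) := by
  obtain ⟨T, -, hT⟩ := Finset.exists_subset_card_eq
    (s := (Finset.univ : Finset (Fin n))) (n := f) (by simp; omega)
  obtain ⟨S, hTS, -, hS⟩ := Finset.exists_subsuperset_card_eq (Finset.subset_univ T)
    (n := n - f) (by omega) (by simp)
  set x : Fin n → ℝ := fun i => if i ∈ T then 1 else 0 with hx
  -- On the complement of `T` the input is constantly zero, which forces `F x = 0`.
  have hzero : ∀ i ∈ Tᶜ, x i = 0 := fun i hi => by
    simp [hx, Finset.mem_compl.mp hi]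
  have hFx : F x = 0 := by
    have h := hrobust x Tᶜ (by simp [Finset.card_compl, hT])
    rw [Finset.sum_eq_zero hzero,
      Finset.sum_eq_zero (fun i hi => by simp [hzero i hi])] at h
    simpa using h
  have hsum : ∑ i ∈ S, x i = f := by
    simp [hx, Finset.inter_eq_right.mpr hTS, hT]
  have h := hrobust x S hS
  rw [hsum, hFx, zero_sub, abs_neg, sq_abs] at h
  set p : ℝ := (S.card : ℝ)⁻¹ * f with hp
  have hvar : ∑ i ∈ S, |x i - p| ^ 2 = f * (1 - 2 * p) + S.card * p ^ 2 := by
    have hterm : ∀ i ∈ S, |x i - p| ^ 2 = x i * (1 - 2 * p) + p ^ 2 := fun i _ => by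
      rw [sq_abs]
      by_cases hi : i ∈ T <;> simp [hx, hi]
      ring
    rw [Finset.sum_congr rfl hterm, Finset.sum_add_distrib, ← Finset.sum_mul, hsum]
    simp
  have hcard : (S.card : ℝ) = n - f := by
    rw [hS, Nat.cast_sub (by omega)]
  have hfn : 2 * (f : ℝ) < n := by exact_mod_cast hf
  have hf0 : (0 : ℝ) < f := by exact_mod_cast hf1
  have hm : (0 : ℝ) < n - f := by linarith
  rw [hvar, hp, hcard] at h
  have hrhs : κ / ((n : ℝ) - f) * (f * (1 - 2 * (((n : ℝ) - f)⁻¹ * f)) +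
      (n - f) * (((n : ℝ) - f)⁻¹ * f) ^ 2) = κ * (n - 2 * f) * (f / (n - f) ^ 2) := by
    field_simp
    ring
  have hlhs : (((n : ℝ) - f)⁻¹ * f) ^ 2 = f * (f / (n - f) ^ 2) := by
    field_simp
  rw [hrhs, hlhs] at h
  rw [ge_iff_le, div_le_iff₀ (by linarith)]
  exact le_of_mul_le_mul_right h (by positivity)
end

section
/- Let n be a positive integer, f an integer with f ≥ 1 and n > 2f, and κ ≥ 0. Suppose Med : ℝ^n → ℝ is an aggregation rule such that Med(x_1,…,x_n) always minimizes y ↦ Σ_{i=1}^n |y − x_i| over ℝ. If Med is (f,κ)-robust, then κ ≥ 1/3. -/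
theorem Fin.sum_filter_val_lt_indicator {n a c : ℕ} (hac : a ≤ c) (hcn : c ≤ n) (g : ℝ → ℝ) :
    ∑ i ∈ Finset.univ.filter (fun i : Fin n => i.val < c), g (if i.val < a then 1 else 0) =
      a * g 1 + (c - a : ℝ) * g 0 := by
  have hg (i : Fin n) : g (if i.val < a then 1 else 0) =
      g 0 + if i.val < a then g 1 - g 0 else 0 := by
    split_ifs <;> ring
  have hfilter : (Finset.univ.filter (fun i : Fin n => i.val < c)).filter (fun i => i.val < a) =
      Finset.univ.filter (fun i : Fin n => i.val < a) := by
    ext i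
    simp only [Finset.mem_filter, Finset.mem_univ, true_and]
    lia
  simp only [hg, Finset.sum_add_distrib, ← Finset.sum_filter, hfilter, Finset.sum_const,
    Fin.card_filter_val_lt, min_eq_right hcn, min_eq_right (hac.trans hcn), nsmul_eq_mul]
  ring


/-- Lower bound for the median: if `Med : ℝⁿ → ℝ` always outputs a minimizer of
`y ↦ ∑ᵢ |y - xᵢ|` and is `(f,κ)`-robust with `f ≥ 1` and `n > 2f`, then `κ ≥ 1/3`. -/
theorem median_kappa_lower_bound (n f : ℕ) (hn : 0 < n) (hf1 : 1 ≤ f) (hf : 2 * f < n)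
    (κ : ℝ) (hκ : 0 ≤ κ)
    (Med : (Fin n → ℝ) → ℝ)
    (hmed : ∀ (x : Fin n → ℝ) (y : ℝ), ∑ i, |Med x - x i| ≤ ∑ i, |y - x i|)
    (hrobust : ∀ (x : Fin n → ℝ) (S : Finset (Fin n)), S.card = n - f →
      |Med x - (S.card : ℝ)⁻¹ * ∑ i ∈ S, x i| ^ 2 ≤
        (κ / (S.card : ℝ)) * ∑ i ∈ S, |x i - (S.card : ℝ)⁻¹ * ∑ j ∈ S, x j| ^ 2) :
    κ ≥ 1 / 3 := by
  obtain ⟨a, ha, ha1⟩ : ∃ a : ℕ, 2 * a < n ∧ n ≤ 2 * a + 2 := ⟨(n - 1) / 2, by lia, by lia⟩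
  have hapos : 1 ≤ a := by lia
  obtain ⟨c, hc⟩ : ∃ c, c = n - f := ⟨_, rfl⟩
  have hac : a < c := by lia
  have hcn : c ≤ n := by lia
  have hc4 : c ≤ 4 * a := by lia
  set x : Fin n → ℝ := fun i => if i.val < a then 1 else 0 with hx
  set S : Finset (Fin n) := Finset.univ.filter (fun i => i.val < c) with hS
  have hcard : S.card = c := by simp [hS, Fin.card_filter_val_lt, hcn]
  have sum_S (g : ℝ → ℝ) : ∑ i ∈ S, g (x i) = a * g 1 + (c - a : ℝ) * g 0 :=
    Fin.sum_filter_val_lt_indicator hac.le hcn g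
  have sum_all (g : ℝ → ℝ) : ∑ i, g (x i) = a * g 1 + (n - a : ℝ) * g 0 := by
    have h := Fin.sum_filter_val_lt_indicator (hac.le.trans hcn) le_rfl g
    simpa using h
  have haR : (2 * a : ℝ) < n := by exact_mod_cast ha
  have haposR : (1 : ℝ) ≤ a := by exact_mod_cast hapos
  have hacR : (a : ℝ) < c := by exact_mod_cast hac
  have hc4R : (c : ℝ) ≤ 4 * a := by exact_mod_cast hc4
  have hMed : Med x = 0 := by
    have h := hmed x 0
    rw [sum_all (fun t => |Med x - t|), sum_all (fun t => |0 - t|)] at h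
    norm_num at h
    have h1 : 1 - |Med x| ≤ |Med x - 1| := by
      rw [abs_sub_comm]
      simpa using abs_sub_abs_le_abs_sub 1 (Med x)
    have h2 := mul_le_mul_of_nonneg_left h1 (by linarith : (0 : ℝ) ≤ a)
    have h3 : (n - 2 * a : ℝ) * |Med x| ≤ 0 := by linarith
    exact abs_nonpos_iff.mp (nonpos_of_mul_nonpos_right h3 (by linarith))
  have h := hrobust x S (hcard.trans hc)
  have hsum := sum_S id
  simp only [id, mul_one, mul_zero, add_zero] at hsum
  rw [hMed, hcard, hsum, sum_S (fun t => |t - (c : ℝ)⁻¹ * a| ^ 2)] at h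
  simp only [sq_abs] at h
  have hcpos : (0 : ℝ) < c := by linarith
  have hvar : κ / c * (a * (1 - (c : ℝ)⁻¹ * a) ^ 2 + (c - a) * (0 - (c : ℝ)⁻¹ * a) ^ 2) =
      κ * (a * (c - a)) / (c : ℝ) ^ 2 := by
    field_simp
    ring
  have hmean : (0 - (c : ℝ)⁻¹ * a) ^ 2 = (a * a) / (c : ℝ) ^ 2 := by
    field_simp
    ring
  rw [hvar, hmean, div_le_div_iff_of_pos_right (by positivity)] at h
  have hratio : (a : ℝ) ≤ κ * (c - a) :=
    le_of_mul_le_mul_left (by linarith : (a : ℝ) * a ≤ a * (κ * (c - a))) (by linarith)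
  have hle : κ * (c - a) ≤ κ * (3 * a) := mul_le_mul_of_nonneg_left (by linarith) hκ
  have hone : (a : ℝ) * 1 ≤ a * (3 * κ) := by linarith
  linarith [le_of_mul_le_mul_left hone (by linarith)]
end

section
/- Let n be a positive integer, f an integer with f ≥ 1 and n > 2f, and κ ≥ 0. Suppose K : ℝ^n → ℝ is an aggregation rule such that for every input (x_1,…,x_n) ∈ ℝ^n, K(x_1,…,x_n) = x_{k*} for some k* minimizing, over j ∈ {1,…,n}, the quantity Σ_{i ∈ N_j} |x_j − x_i|², where for each j the set N_j ⊆ {1,…,n} with |N_j| = n − f consists of indices of n − f nearest neighbors of x_j among the inputs (i.e., for all i ∈ N_j and l ∉ N_j, |x_j − x_i| ≤ |x_j − x_l|). If K is (f,κ)-robust, then κ ≥ 1/3. -/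
/-- Lower bound for Krum: suppose `K : ℝⁿ → ℝ` always outputs an input `x k*` whose
index minimizes the sum of squared distances to its `n - f` nearest neighbors
(for some valid choice of nearest-neighbor sets `N j` of size `n - f`).
If `K` is `(f,κ)`-robust with `f ≥ 1` and `n > 2f`, then `κ ≥ 1/3`. -/
theorem krum_kappa_lower_bound (n f : ℕ) (hn : 0 < n) (hf1 : 1 ≤ f) (hf : 2 * f < n)
    (κ : ℝ) (hκ : 0 ≤ κ)
    (K : (Fin n → ℝ) → ℝ)
    (hkrum : ∀ x : Fin n → ℝ, ∃ (N : Fin n → Finset (Fin n)) (k : Fin n),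
      (∀ j, (N j).card = n - f) ∧
      (∀ j : Fin n, ∀ i ∈ N j, ∀ l ∉ N j, |x j - x i| ≤ |x j - x l|) ∧
      (∀ j : Fin n, ∑ i ∈ N k, |x k - x i| ^ 2 ≤ ∑ i ∈ N j, |x j - x i| ^ 2) ∧
      K x = x k)
    (hrobust : ∀ (x : Fin n → ℝ) (S : Finset (Fin n)), S.card = n - f →
      |K x - (S.card : ℝ)⁻¹ * ∑ i ∈ S, x i| ^ 2 ≤
        (κ / (S.card : ℝ)) * ∑ i ∈ S, |x i - (S.card : ℝ)⁻¹ * ∑ j ∈ S, x j| ^ 2) :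
    κ ≥ 1 / 3 := by
  obtain ⟨S, -, hS⟩ := Finset.exists_subset_card_eq (s := (Finset.univ : Finset (Fin n)))
    (n := n - f) (by simp)
  obtain ⟨T, hTS, hT⟩ := Finset.exists_subset_card_eq (s := S) (n := (n - f) / 2) (by omega)
  obtain ⟨q, hq⟩ : ∃ q, q = (n - f) / 2 := ⟨_, rfl⟩
  obtain ⟨m, hm⟩ : ∃ m, m = n - f := ⟨_, rfl⟩
  have hq1 : (1 : ℝ) ≤ q := by exact_mod_cast (by omega : 1 ≤ q)
  have hqm : 2 * (q : ℝ) ≤ m := by exact_mod_cast (by omega : 2 * q ≤ m)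
  have hmq : (m : ℝ) ≤ 2 * q + 1 := by exact_mod_cast (by omega : m ≤ 2 * q + 1)
  have hm0 : (0 : ℝ) < m := by linarith
  let x : Fin n → ℝ := fun i => if i ∈ T then 1 else 0
  have hsum : ∑ i ∈ S, x i = q := by
    simp [x, Finset.inter_eq_right.mpr hTS, hT, hq]
  have hx_sq (i : Fin n) (μ : ℝ) : |x i - μ| ^ 2 = x i * (1 - 2 * μ) + μ ^ 2 := by
    rw [sq_abs]
    by_cases hi : i ∈ T <;> simp only [x, hi, if_true, if_false] <;> ring
  obtain ⟨N, k, -, -, -, hK⟩ := hkrum x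
  have hr := hrobust x S hS
  rw [hsum, hK, hx_sq, Finset.sum_congr rfl (fun i _ => hx_sq i _), Finset.sum_add_distrib,
    ← Finset.sum_mul, hsum, Finset.sum_const, nsmul_eq_mul, hS, ← hm] at hr
  have hr' : x k * (m * (m - 2 * q)) + (q : ℝ) ^ 2 ≤ κ * (q * (m - q)) := by
    have h := mul_le_mul_of_nonneg_left hr (sq_nonneg (m : ℝ))
    field_simp at h
    nlinarith [h]
  by_cases hk : k ∈ T
  · simp only [x, hk, if_true] at hr'
    have : (m : ℝ) - q ≤ κ * q := by
      refine le_of_mul_le_mul_right ?_ (by linarith : (0 : ℝ) < m - q)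
      linarith
    nlinarith
  · simp only [x, hk, if_false] at hr'
    have : (q : ℝ) ≤ κ * (m - q) := by
      refine le_of_mul_le_mul_right ?_ (by linarith : (0 : ℝ) < q)
      linarith
    nlinarith
end

section
/- Let n be a positive integer, f an integer with f ≥ 1 and n > 2f, and consider the instance x_1, …, x_n ∈ ℝ where x_i = −1 for i ≤ ⌊(n−f)/2⌋ and x_i = +1 for i > ⌊(n−f)/2⌋. Let S = {1,…,n−f} and x̄_S = (1/(n−f)) Σ_{i∈S} x_i. Then: (i) x̄_S = 0 if n − f is even and x̄_S = 1/(n−f) if n − f is odd; (ii) (1/(n−f)) Σ_{i∈S} |x_i − x̄_S|² = 1 − x̄_S²; and (iii) the ratio |1 − x̄_S|² / (1 − x̄_S²) is at least 1/3. -/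
theorem Fin.sum_filter_val_lt {M : Type*} [AddCommMonoid M] {n m : ℕ} (h : m ≤ n) (g : ℕ → M) :
    ∑ i ∈ Finset.univ.filter (fun i : Fin n => (i : ℕ) < m), g i = ∑ i ∈ Finset.range m, g i := by
  rw [Finset.sum_filter, Fin.sum_univ_eq_sum_range (fun i => if i < m then g i else 0) n,
    ← Finset.sum_filter]
  congr 1
  ext i
  simp only [Finset.mem_filter, Finset.mem_range]
  omega

theorem sum_range_add_neg_one_one (k d : ℕ) :
    ∑ i ∈ Finset.range (k + d), (if i < k then (-1 : ℝ) else 1) = d - k := by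
  rw [Finset.sum_range_add, Finset.sum_congr rfl
    (fun i hi => if_pos (Finset.mem_range.mp hi) : ∀ i ∈ Finset.range k, _ = (-1 : ℝ))]
  simp
  ring

/-- The empirical variance of a `±1`-valued family, in terms of its empirical mean. -/
theorem variance_of_sq_eq_one {ι : Type*} (S : Finset ι) (hS : S.Nonempty) (x : ι → ℝ)
    (hx : ∀ i, x i ^ 2 = 1) (b : ℝ) (hb : b = (S.card : ℝ)⁻¹ * ∑ i ∈ S, x i) :
    (S.card : ℝ)⁻¹ * ∑ i ∈ S, |x i - b| ^ 2 = 1 - b ^ 2 := by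
  have hc : (S.card : ℝ) ≠ 0 := by exact_mod_cast hS.card_pos.ne'
  have hterm : ∀ i ∈ S, |x i - b| ^ 2 = (1 + b ^ 2) - 2 * b * x i := fun i _ => by
    rw [sq_abs, sub_sq, hx]
    ring
  rw [Finset.sum_congr rfl hterm, Finset.sum_sub_distrib, ← Finset.mul_sum, Finset.sum_const,
    nsmul_eq_mul, mul_sub, inv_mul_cancel_left₀ hc, mul_left_comm, ← hb]
  ring

theorem one_third_le_ratio {b : ℝ} (h0 : 0 ≤ b) (h1 : b ≤ 1 / 2) :
    |1 - b| ^ 2 / (1 - b ^ 2) ≥ 1 / 3 := by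
  rw [sq_abs, ge_iff_le, le_div_iff₀ (by nlinarith)]
  nlinarith

/-- The explicit instance used for the lower bound on `κ`: with `x i = -1` for the
first `⌊(n-f)/2⌋` indices and `x i = 1` otherwise, and `S` the (zero-indexed) set
`{0, …, n-f-1}` of the first `n - f` indices:
(i) the average `x̄_S` is `0` if `n - f` is even and `1/(n-f)` if `n - f` is odd;
(ii) the empirical variance over `S` equals `1 - x̄_S²`;
(iii) the ratio `|1 - x̄_S|² / (1 - x̄_S²)` is at least `1/3`. -/
theorem lower_bound_instance (n f : ℕ) (hn : 0 < n) (hf1 : 1 ≤ f) (hf : 2 * f < n) :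
    let x : Fin n → ℝ := fun i => if (i : ℕ) < (n - f) / 2 then -1 else 1
    let S : Finset (Fin n) := Finset.univ.filter (fun i => (i : ℕ) < n - f)
    let xbar : ℝ := (S.card : ℝ)⁻¹ * ∑ i ∈ S, x i
    ((Even (n - f) → xbar = 0) ∧ (¬ Even (n - f) → xbar = 1 / ((n : ℝ) - f))) ∧
    (S.card : ℝ)⁻¹ * ∑ i ∈ S, |x i - xbar| ^ 2 = 1 - xbar ^ 2 ∧
    |1 - xbar| ^ 2 / (1 - xbar ^ 2) ≥ 1 / 3 := by
  intro x S xbar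
  have hcard : S.card = n - f := by
    have h := Fin.sum_filter_val_lt (Nat.sub_le n f) (fun _ => 1)
    simpa [S] using h
  have hsum : ∑ i ∈ S, x i = ((n - f : ℕ) : ℝ) - 2 * ((n - f) / 2 : ℕ) := by
    obtain ⟨d, hd⟩ := Nat.exists_eq_add_of_le (Nat.div_le_self (n - f) 2)
    have h := sum_range_add_neg_one_one ((n - f) / 2) d
    have hd' : ((n - f : ℕ) : ℝ) = ((n - f) / 2 : ℕ) + d := by exact_mod_cast hd
    rw [← hd] at h
    refine (Fin.sum_filter_val_lt (Nat.sub_le n f)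
      (fun i => if i < (n - f) / 2 then (-1 : ℝ) else 1)).trans (h.trans ?_)
    rw [hd']
    ring
  have hxbar : xbar = ((n - f : ℕ) : ℝ)⁻¹ * (((n - f : ℕ) : ℝ) - 2 * ((n - f) / 2 : ℕ)) := by
    rw [← hsum, ← hcard]
  have heven : Even (n - f) → xbar = 0 := fun h => by
    have h2 : ((n - f : ℕ) : ℝ) = 2 * ((n - f) / 2 : ℕ) := by
      exact_mod_cast (Nat.two_mul_div_two_of_even h).symm
    rw [hxbar, ← h2, sub_self, mul_zero]
  have hodd : ¬ Even (n - f) → xbar = ((n - f : ℕ) : ℝ)⁻¹ := fun h => by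
    have h2 : ((n - f : ℕ) : ℝ) = 2 * ((n - f) / 2 : ℕ) + 1 := by
      exact_mod_cast (Nat.two_mul_div_two_add_one_of_odd (Nat.not_even_iff_odd.mp h)).symm
    rw [hxbar, sub_eq_of_eq_add' h2, mul_one]
  refine ⟨⟨heven, fun h => ?_⟩, ?_, ?_⟩
  · rw [hodd h, Nat.cast_sub (by omega), one_div]
  · refine variance_of_sq_eq_one S (Finset.card_pos.mp (by omega)) x (fun i => ?_) xbar rfl
    dsimp only [x]
    split_ifs <;> norm_num
  · by_cases h : Even (n - f)
    · rw [heven h]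
      norm_num
    · have h2 : (2 : ℝ) ≤ ((n - f : ℕ) : ℝ) := by exact_mod_cast (by omega : 2 ≤ n - f)
      rw [hodd h]
      refine one_third_le_ratio (by positivity) ?_
      rw [one_div]
      exact inv_anti₀ two_pos h2
end

section
/- Let n be a positive integer, f an integer with 0 ≤ f < n/2, and x_1, …, x_n real numbers sorted in non-decreasing order. Let S ⊆ {1,…,n} with |S| = n − f, let I = {f+1,…,n−f}, let I⁻ = {1,…,f} and I⁺ = {n−f+1,…,n}, and let q = |I \ S|. Then |I⁺ ∩ S| ≥ q and |I⁻ ∩ S| ≥ q; consequently there exists an injection φ : I \ S → S \ I such that |x_i − y| ≤ |x_{φ(i)} − y| for every i ∈ I \ S, where y = (1/|S|) Σ_{i∈S} x_i. -/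
/-- If `A` and `B` are disjoint and `A` has at least as many elements as the complement of `S`,
then at least as many elements of `A` lie in `S` as elements of `B` lie outside `S`. -/
theorem card_sdiff_le_card_inter_of_disjoint {α : Type*} [Fintype α] [DecidableEq α]
    {A B S : Finset α} (hAB : Disjoint A B) (hA : Sᶜ.card ≤ A.card) :
    (B \ S).card ≤ (A ∩ S).card := by
  have hdisj : Disjoint (A \ S) (B \ S) :=
    hAB.mono Finset.sdiff_subset Finset.sdiff_subset
  have hsub : (A \ S) ∪ (B \ S) ⊆ Sᶜ := by
    intro i
    simp only [Finset.mem_union, Finset.mem_sdiff, Finset.mem_compl]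
    tauto
  have hle := Finset.card_le_card hsub
  rw [Finset.card_union_of_disjoint hdisj] at hle
  have := Finset.card_inter_add_card_sdiff A S
  omega

theorem exists_mapsTo_injOn_of_card_le {α β : Type*} [Nonempty β]
    {s : Finset α} {t : Finset β} (h : s.card ≤ t.card) :
    ∃ g : α → β, (∀ i ∈ s, g i ∈ t) ∧ Set.InjOn g s := by
  obtain ⟨g, hg, hinj⟩ := s.finite_toSet.exists_injOn_of_encard_le (t := (t : Set β))
    (by simpa using h)
  exact ⟨g, fun i hi => hg hi, hinj⟩

/-- Injection lemma for the trimmed mean: for sorted reals, with `I` the kept middle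
indices, `I⁻` the `f` smallest indices, `I⁺` the `f` largest indices (all zero-indexed),
and `q = |I \ S|`, we have `|I⁺ ∩ S| ≥ q` and `|I⁻ ∩ S| ≥ q`; consequently there is an
injection `φ : I \ S → S \ I` with `|x i - y| ≤ |x (φ i) - y|` for all `i ∈ I \ S`,
where `y` is the average over `S`. -/
theorem tmean_injection (n f : ℕ) (hn : 0 < n) (hf : 2 * f < n) (x : Fin n → ℝ)
    (hsorted : Monotone x) (S : Finset (Fin n)) (hS : S.card = n - f) :
    let I : Finset (Fin n) := Finset.univ.filter (fun i => f ≤ (i : ℕ) ∧ (i : ℕ) < n - f)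
    let Iminus : Finset (Fin n) := Finset.univ.filter (fun i => (i : ℕ) < f)
    let Iplus : Finset (Fin n) := Finset.univ.filter (fun i => n - f ≤ (i : ℕ))
    let q : ℕ := (I \ S).card
    let y : ℝ := (S.card : ℝ)⁻¹ * ∑ i ∈ S, x i
    q ≤ (Iplus ∩ S).card ∧ q ≤ (Iminus ∩ S).card ∧
      ∃ φ : Fin n → Fin n, Set.InjOn φ ↑(I \ S) ∧
        (∀ i ∈ I \ S, φ i ∈ S \ I) ∧
        (∀ i ∈ I \ S, |x i - y| ≤ |x (φ i) - y|) := by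
  intro I Iminus Iplus q y
  have hcompl : Sᶜ.card = f := by
    rw [Finset.card_compl, Fintype.card_fin, hS]; omega
  have hminus : Iminus.card = f := by
    simp only [Iminus, Fin.card_filter_val_lt]; omega
  have hplus : Iplus.card = f := by
    have h := Finset.card_filter_add_card_filter_not (s := Finset.univ)
      (fun i : Fin n => (i : ℕ) < n - f)
    simp only [Fin.card_filter_val_lt, not_lt, Finset.card_univ, Fintype.card_fin] at h
    simp only [Iplus]; omega
  have hdisjPlus : Disjoint Iplus I := by
    simp only [Finset.disjoint_left, Iplus, I, Finset.mem_filter_univ]; omega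
  have hdisjMinus : Disjoint Iminus I := by
    simp only [Finset.disjoint_left, Iminus, I, Finset.mem_filter_univ]; omega
  have hqPlus : q ≤ (Iplus ∩ S).card :=
    card_sdiff_le_card_inter_of_disjoint hdisjPlus (by omega)
  have hqMinus : q ≤ (Iminus ∩ S).card :=
    card_sdiff_le_card_inter_of_disjoint hdisjMinus (by omega)
  refine ⟨hqPlus, hqMinus, ?_⟩
  have : Nonempty (Fin n) := ⟨⟨0, hn⟩⟩
  obtain ⟨u, hu, huInj⟩ := exists_mapsTo_injOn_of_card_le hqPlus
  obtain ⟨v, hv, hvInj⟩ := exists_mapsTo_injOn_of_card_le hqMinus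
  have hu_mem : ∀ i ∈ I \ S, n - f ≤ (u i : ℕ) ∧ u i ∈ S := fun i hi => by
    simpa [Iplus] using hu i hi
  have hv_mem : ∀ i ∈ I \ S, (v i : ℕ) < f ∧ v i ∈ S := fun i hi => by
    simpa [Iminus] using hv i hi
  have hI_mem : ∀ i ∈ I \ S, f ≤ (i : ℕ) ∧ (i : ℕ) < n - f := fun i hi => by
    simpa [I] using (Finset.mem_sdiff.mp hi).1
  refine ⟨fun i => if y ≤ x i then u i else v i, ?_, ?_, ?_⟩
  · intro i hi j hj hij
    have hui := (hu_mem i hi).1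
    have huj := (hu_mem j hj).1
    have hvi := (hv_mem i hi).1
    have hvj := (hv_mem j hj).1
    dsimp only at hij
    split_ifs at hij
    · exact huInj hi hj hij
    · have := congrArg Fin.val hij
      omega
    · have := congrArg Fin.val hij
      omega
    · exact hvInj hi hj hij
  · intro i hi
    obtain ⟨hui, huS⟩ := hu_mem i hi
    obtain ⟨hvi, hvS⟩ := hv_mem i hi
    dsimp only
    split_ifs
    · simp only [Finset.mem_sdiff, I, Finset.mem_filter_univ]
      exact ⟨huS, by omega⟩
    · simp only [Finset.mem_sdiff, I, Finset.mem_filter_univ]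
      exact ⟨hvS, by omega⟩
  · intro i hi
    have hui := (hu_mem i hi).1
    have hvi := (hv_mem i hi).1
    obtain ⟨hi₁, hi₂⟩ := hI_mem i hi
    dsimp only
    split_ifs with h
    · have hle : x i ≤ x (u i) := hsorted (Fin.le_def.mpr (by omega))
      rw [abs_of_nonneg (sub_nonneg.mpr h), abs_of_nonneg (sub_nonneg.mpr (h.trans hle))]
      linarith
    · have hle : x (v i) ≤ x i := hsorted (Fin.le_def.mpr (by omega))
      rw [abs_of_nonpos (by linarith), abs_of_nonpos (by linarith)]
      linarith
end
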